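/- For every natural number n > 20, there exist at least n prime numbers in the interval [n·ln n, 3·n·ln n). -/

import Mathlib

open Finset ArithmeticFunction Chebyshev

theorem log_factorial_eq_sum_vonMangoldt {k N : ℕ} (h : k ≤ N) :
    Real.log (k.factorial) = ∑ m ∈ Ioc 0 N, vonMangoldt m * (k / m : ℕ) := by
  induction k with
  | zero => simp
  | succ k ih =>
    rw [Nat.factorial_succ, Nat.cast_mul,
      Real.log_mul (by positivity) (by positivity), ih (by omega), ← vonMangoldt_sum]
    have hdiv : (k + 1).divisors = {m ∈ Ioc 0 N | m ∣ k + 1} := by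
      ext m
      simp only [Nat.mem_divisors, mem_filter, mem_Ioc]
      constructor
      · rintro ⟨hm, -⟩
        exact ⟨⟨Nat.pos_of_dvd_of_pos hm (by omega), (Nat.le_of_dvd (by omega) hm).trans h⟩, hm⟩
      · rintro ⟨-, hm⟩
        exact ⟨hm, by omega⟩
    rw [hdiv, sum_filter, ← sum_add_distrib]
    refine sum_congr rfl fun m _ ↦ ?_
    rw [Nat.succ_div]
    split_ifs <;> push_cast <;> ring

theorem div_combination_le {M m : ℕ} (hm : 0 < m) :
    6 * M / m + M / m ≤
      3 * M / m + 2 * (2 * M / m) + if 2 * M < m ∨ m ≤ 6 * M / 5 then 1 else 0 := by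
  have h1 : M / m = 6 * M / m / 6 := by
    rw [Nat.div_div_eq_div_mul, mul_comm m, ← Nat.div_div_eq_div_mul]; congr 1; omega
  have h2 : 3 * M / m = 6 * M / m / 2 := by
    rw [Nat.div_div_eq_div_mul, mul_comm m, ← Nat.div_div_eq_div_mul]; congr 1; omega
  have h3 : 2 * M / m = 6 * M / m / 3 := by
    rw [Nat.div_div_eq_div_mul, mul_comm m, ← Nat.div_div_eq_div_mul]; congr 1; omega
  rw [h1, h2, h3]
  split_ifs with h
  · omega
  · have h4 : 3 ≤ 6 * M / m := (Nat.le_div_iff_mul_le hm).2 (by omega)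
    have h5 : 6 * M / m < 5 := (Nat.div_lt_iff_lt_mul hm).2 (by omega)
    omega

theorem pow_le_factorial_ratio {M : ℕ} (hM : 1 ≤ M) :
    108 ^ M * ((3 * M).factorial * (2 * M).factorial ^ 2) ≤
      4 * M * ((6 * M).factorial * M.factorial) := by
  induction M, hM using Nat.le_induction with
  | base => decide
  | succ M hM ih =>
    have e6 : (6 * (M + 1)).factorial = (6 * M + 6) * (6 * M + 5) * (6 * M + 4) * (6 * M + 3) *
        (6 * M + 2) * (6 * M + 1) * (6 * M).factorial := by
      simp only [show 6 * (M + 1) = 6 * M + 5 + 1 by ring, Nat.factorial_succ]; ring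
    have e3 : (3 * (M + 1)).factorial =
        (3 * M + 3) * (3 * M + 2) * (3 * M + 1) * (3 * M).factorial := by
      simp only [show 3 * (M + 1) = 3 * M + 2 + 1 by ring, Nat.factorial_succ]; ring
    have e2 : (2 * (M + 1)).factorial = (2 * M + 2) * (2 * M + 1) * (2 * M).factorial := by
      simp only [show 2 * (M + 1) = 2 * M + 1 + 1 by ring, Nat.factorial_succ]; ring
    rw [e6, e3, e2, Nat.factorial_succ M]
    have key : 108 * (M * ((3 * M + 3) * (3 * M + 2) * (3 * M + 1) *
        ((2 * M + 2) * (2 * M + 1)) ^ 2)) ≤ (M + 1) * ((6 * M + 6) * (6 * M + 5) * (6 * M + 4) *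
        (6 * M + 3) * (6 * M + 2) * (6 * M + 1) * (M + 1)) := by
      have : 18 * (M * ((2 * M + 1) * (M + 1))) ≤ (M + 1) * ((6 * M + 1) * (6 * M + 5)) := by
        nlinarith
      calc _ = 18 * (M * ((2 * M + 1) * (M + 1))) *
            (24 * (M + 1) ^ 2 * (3 * M + 1) * (3 * M + 2) * (6 * M + 3)) := by ring
        _ ≤ (M + 1) * ((6 * M + 1) * (6 * M + 5)) *
            (24 * (M + 1) ^ 2 * (3 * M + 1) * (3 * M + 2) * (6 * M + 3)) := by gcongr
        _ = _ := by ring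
    refine Nat.le_of_mul_le_mul_left ?_ hM
    calc _ = 108 * (M * ((3 * M + 3) * (3 * M + 2) * (3 * M + 1) *
        ((2 * M + 2) * (2 * M + 1)) ^ 2)) *
          (108 ^ M * ((3 * M).factorial * (2 * M).factorial ^ 2)) := by ring
      _ ≤ (M + 1) * ((6 * M + 6) * (6 * M + 5) * (6 * M + 4) *
        (6 * M + 3) * (6 * M + 2) * (6 * M + 1) * (M + 1)) *
          (4 * M * ((6 * M).factorial * M.factorial)) := Nat.mul_le_mul key ih
      _ = _ := by ring

theorem psi_sub_theta_le_primeCounting_sqrt (n : ℕ) :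
    ψ n - θ n ≤ Nat.primeCounting n.sqrt * Real.log n := by
  rcases n.eq_zero_or_pos with rfl | hn
  · simp
  rw [psi_eq_sum_mul_log_prime, theta_eq_sum_primesLE_log, ← sum_sub_distrib,
    ← Nat.primesLE_card_eq_primeCounting, ← nsmul_eq_mul, ← sum_const]
  have hsub : Nat.primesLE n.sqrt ⊆ Nat.primesLE n := fun p hp ↦ by
    rw [Nat.mem_primesLE] at hp ⊢
    exact ⟨hp.1.trans n.sqrt_le_self, hp.2⟩
  rw [← sum_subset hsub (f := fun p ↦ Nat.log p n * Real.log p - Real.log p)]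
  · refine sum_le_sum fun p hp ↦ ?_
    have hp1 : 1 ≤ p := (Nat.one_lt_of_mem_primesLE hp).le
    have h : Nat.log p n * Real.log p ≤ Real.log n := by
      rw [← Real.log_pow]
      exact Real.log_le_log (by positivity) (mod_cast Nat.pow_log_le_self p hn.ne')
    have : 0 ≤ Real.log p := Real.log_natCast_nonneg p
    linarith
  · intro p hp hps
    rw [Nat.mem_primesLE] at hp hps
    have hlt : n < p ^ 2 := by
      rw [sq, ← Nat.sqrt_lt]
      by_contra! h
      exact hps ⟨h, hp.2⟩
    have : Nat.log p n = 1 := by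
      refine le_antisymm (Nat.lt_succ_iff.1 (Nat.log_lt_of_lt_pow hn.ne' hlt)) ?_
      exact Nat.le_log_of_pow_le hp.2.one_lt (by simpa using hp.1)
    simp [this]

theorem primeCounting_le_half_add_one (n : ℕ) : (Nat.primeCounting n : ℝ) ≤ n / 2 + 1 := by
  have h : 2 * Nat.primeCounting n ≤ n + 2 := by
    rcases lt_or_ge n 2 with h | h
    · interval_cases n <;> decide
    · obtain ⟨k, rfl⟩ := Nat.exists_eq_add_of_le h
      have := Nat.primeCounting'_add_le (a := 2) (k := 3) (by simp) (by simp) k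
      have h3 : Nat.primeCounting' 3 = 1 := by decide
      rw [h3, Nat.totient_two, show 3 + k = 2 + k + 1 by ring] at this
      simp only [Nat.primeCounting]
      omega
  have : (2 * Nat.primeCounting n : ℝ) ≤ n + 2 := mod_cast h
  linarith

theorem card_primes_Ioc_mul_log_ge {M : ℕ} (hM : 1 ≤ M) :
    M * Real.log 108 - Real.log (4 * M) - Real.log 4 * (6 * M / 5) -
        (√(6 * M) / 2 + 1) * Real.log (6 * M) ≤
      #{p ∈ Ioc (2 * M) (6 * M) | p.Prime} * Real.log (6 * M) := by
  set c : ℕ → ℝ := fun m ↦ if 2 * M < m ∨ m ≤ 6 * M / 5 then 1 else 0 with hc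
  have hM0 : (0 : ℝ) < M := by positivity
  have hratio : M * Real.log 108 - Real.log (4 * M) ≤ ∑ m ∈ Ioc 0 (6 * M), vonMangoldt m * c m := by
    have h := Real.log_le_log (by positivity)
      (show ((108 ^ M * ((3 * M).factorial * (2 * M).factorial ^ 2) : ℕ) : ℝ) ≤
        (4 * M * ((6 * M).factorial * M.factorial) : ℕ) from mod_cast pow_le_factorial_ratio hM)
    push_cast at h
    rw [Real.log_mul (by positivity) (by positivity), Real.log_mul (by positivity) (by positivity),
      Real.log_mul (x := 4 * (M : ℝ)) (by positivity) (by positivity),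
      Real.log_mul (x := ((6 * M).factorial : ℝ)) (by positivity) (by positivity),
      Real.log_pow, Real.log_pow,
      log_factorial_eq_sum_vonMangoldt (show 3 * M ≤ 6 * M by omega),
      log_factorial_eq_sum_vonMangoldt (show 2 * M ≤ 6 * M by omega),
      log_factorial_eq_sum_vonMangoldt (show M ≤ 6 * M by omega),
      log_factorial_eq_sum_vonMangoldt (le_refl (6 * M))] at h
    have h' : M * Real.log 108 - Real.log (4 * M) ≤ ∑ m ∈ Ioc 0 (6 * M), vonMangoldt m *
        ((6 * M / m : ℕ) + (M / m : ℕ) - (3 * M / m : ℕ) - 2 * (2 * M / m : ℕ)) := by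
      simp only [mul_sub, mul_add, sum_sub_distrib, sum_add_distrib, mul_left_comm _ (2 : ℝ),
        ← mul_sum]
      push_cast at h
      linarith
    refine h'.trans (sum_le_sum fun m hm ↦ ?_)
    refine mul_le_mul_of_nonneg_left ?_ vonMangoldt_nonneg
    have h := Nat.cast_le (α := ℝ).2 (div_combination_le (M := M) (mem_Ioc.1 hm).1)
    push_cast at h
    simp only [hc]
    linarith
  have hsplit : ∑ m ∈ Ioc 0 (6 * M), vonMangoldt m * c m ≤
      (∑ p ∈ Ioc (2 * M) (6 * M) with p.Prime, Real.log p) + θ (6 * M / 5 : ℕ) +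
        (ψ (6 * M : ℕ) - θ (6 * M : ℕ)) := by
    have hsub : Ioc 0 (6 * M / 5) ⊆ Ioc 0 (6 * M) := Ioc_subset_Ioc_right (by omega)
    have hsub' : Ioc (2 * M) (6 * M) ⊆ Ioc 0 (6 * M) := Ioc_subset_Ioc_left (by omega)
    rw [psi_sub_theta_eq_sum_not_prime, theta]
    simp only [Nat.floor_natCast]
    rw [sum_filter, sum_filter, sum_filter, ← inter_eq_right.2 hsub, ← inter_eq_right.2 hsub',
      ← sum_ite_mem, ← sum_ite_mem, ← sum_add_distrib, ← sum_add_distrib]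
    refine sum_le_sum fun m hm ↦ ?_
    have hΛ : 0 ≤ vonMangoldt m := vonMangoldt_nonneg
    have hlog : 0 ≤ Real.log m := Real.log_natCast_nonneg m
    simp only [mem_Ioc] at hm ⊢
    by_cases hp : m.Prime
    · simp only [hc, hp, vonMangoldt_apply_prime, hm, true_and, and_true, if_true, not_true,
        if_false]
      split_ifs <;> first | linarith | tauto
    · simp only [hc, hp, if_false, not_false_eq_true, if_true, ite_self]
      split_ifs <;> linarith
  have hlogM : 0 ≤ Real.log (6 * M) := by
    have := Real.log_natCast_nonneg (6 * M); push_cast at this; exact this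
  have hcard : ∑ p ∈ Ioc (2 * M) (6 * M) with p.Prime, Real.log p ≤
      #{p ∈ Ioc (2 * M) (6 * M) | p.Prime} * Real.log (6 * M) := by
    rw [← nsmul_eq_mul]
    refine sum_le_card_nsmul _ _ _ fun p hp ↦ ?_
    simp only [mem_filter, mem_Ioc] at hp
    exact Real.log_le_log (mod_cast hp.2.pos) (mod_cast hp.1.2)
  have htheta : θ (6 * M / 5 : ℕ) ≤ Real.log 4 * (6 * M / 5) := by
    refine (theta_le_log4_mul_x (Nat.cast_nonneg _)).trans ?_
    have := Nat.cast_div_le (α := ℝ) (m := 6 * M) (n := 5)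
    push_cast at this
    gcongr
  have hpsi : ψ (6 * M : ℕ) - θ (6 * M : ℕ) ≤ (√(6 * M) / 2 + 1) * Real.log (6 * M) := by
    refine (psi_sub_theta_le_primeCounting_sqrt _).trans ?_
    have h1 := primeCounting_le_half_add_one (Nat.sqrt (6 * M))
    have h2 : (Nat.sqrt (6 * M) : ℝ) ≤ √(6 * M) := mod_cast Real.nat_sqrt_le_real_sqrt (a := 6 * M)
    push_cast
    gcongr
    linarith
  linarith

/-- The number of members of `[lo, lo + k)` coprime to `P`, written for fast kernel evaluation. -/
def coprimeCount (P lo k : ℕ) : ℕ :=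
  Nat.rec 0 (fun i s ↦ Nat.add s (Nat.div 1 (Nat.gcd (Nat.add lo i) P))) k

/-- The sum of the `coprimeCount`s of `k` consecutive intervals of length `32` from `lo` on. -/
def coprimeCountChunks (P lo k : ℕ) : ℕ :=
  Nat.rec 0 (fun i s ↦ Nat.add s (coprimeCount P (Nat.add lo (Nat.mul 32 i)) 32)) k

theorem card_coprime_Ico_add (P lo i j : ℕ) :
    #{m ∈ Ico lo (lo + (i + j)) | m.Coprime P} =
      #{m ∈ Ico lo (lo + i) | m.Coprime P} + #{m ∈ Ico (lo + i) (lo + i + j) | m.Coprime P} := by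
  rw [← add_assoc, ← Ico_union_Ico_eq_Ico (Nat.le_add_right lo i) (Nat.le_add_right _ j),
    filter_union, card_union_of_disjoint
      (disjoint_filter_filter (Ico_disjoint_Ico_consecutive _ _ _))]

theorem coprimeCount_le_card (P lo k : ℕ) :
    coprimeCount P lo k ≤ #{m ∈ Ico lo (lo + k) | m.Coprime P} := by
  induction k with
  | zero => exact Nat.zero_le _
  | succ k ih =>
    rw [card_coprime_Ico_add]
    change coprimeCount P lo k + 1 / (lo + k).gcd P ≤ _
    refine add_le_add ih ?_
    simp only [Nat.Ico_succ_singleton, filter_singleton, Nat.coprime_iff_gcd_eq_one]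
    split_ifs with h
    · simp [h]
    · rcases Nat.lt_or_gt_of_ne h with h | h
      · simp [Nat.lt_one_iff.1 h]
      · simp [Nat.div_eq_of_lt h]

theorem coprimeCountChunks_le_card (P lo k : ℕ) :
    coprimeCountChunks P lo k ≤ #{m ∈ Ico lo (lo + 32 * k) | m.Coprime P} := by
  induction k with
  | zero => exact Nat.zero_le _
  | succ k ih =>
    rw [mul_add_one, card_coprime_Ico_add]
    exact add_le_add ih (coprimeCount_le_card P (lo + 32 * k) 32)

theorem prime_of_coprime_factorial {m k : ℕ} (hm : 1 < m) (hmk : m < (k + 1) ^ 2)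
    (h : m.Coprime k.factorial) : m.Prime := by
  by_contra hp
  have hle : m.minFac ≤ k := by
    have := Nat.minFac_sq_le_self (by omega) hp
    exact Nat.lt_succ_iff.1 (lt_of_pow_lt_pow_left₀ 2 (by omega) (this.trans_lt hmk))
  have hdvd := Nat.dvd_factorial m.minFac_pos hle
  exact (Nat.minFac_prime hm.ne').one_lt.ne' (Nat.eq_one_of_dvd_coprimes h m.minFac_dvd hdvd)

theorem card_coprime_factorial_le_ncard {k lo hi : ℕ} (hlo : 1 < lo) (hhi : hi ≤ (k + 1) ^ 2)
    {x y : ℝ} (hx : x ≤ lo) (hy : hi ≤ y) :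
    #{m ∈ Ico lo hi | m.Coprime k.factorial} ≤
      {p : ℕ | p.Prime ∧ x ≤ p ∧ (p : ℝ) < y}.ncard := by
  rw [← Set.ncard_coe_finset]
  refine Set.ncard_le_ncard (fun m hm ↦ ?_) ?_
  · simp only [coe_filter, mem_Ico, Set.mem_ofPred_eq] at hm
    refine ⟨prime_of_coprime_factorial (by omega) (by omega) hm.2, ?_, ?_⟩
    · exact hx.trans (mod_cast hm.1.1)
    · exact lt_of_lt_of_le (mod_cast hm.1.2) hy
  · exact (Set.finite_Iio ⌈y⌉₊).subset fun p hp ↦ Nat.lt_ceil.2 hp.2.2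

theorem mul_log_le_of_pow_le {b lo : ℕ} (hb : 0 < b) (h : b ^ b * 10000 ^ lo ≤ 27182 ^ lo) :
    b * Real.log b ≤ lo := by
  rw [← Real.log_pow, Real.log_le_iff_le_exp (by positivity), ← mul_one (lo : ℝ), Real.exp_nat_mul]
  have h' : (b : ℝ) ^ b * 10000 ^ lo ≤ 27182 ^ lo := mod_cast h
  calc (b : ℝ) ^ b ≤ (27182 / 10000) ^ lo := by rw [div_pow, le_div_iff₀ (by positivity)]; exact h'
    _ ≤ _ := by gcongr; linarith [Real.exp_one_gt_d9]

theorem le_mul_log_of_le_pow {a hi c : ℕ} (ha : 0 < a) (h : 27183 ^ hi ≤ 10000 ^ hi * a ^ c) :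
    hi ≤ c * Real.log a := by
  rw [← Real.log_pow, Real.le_log_iff_exp_le (by positivity), ← mul_one (hi : ℝ), Real.exp_nat_mul]
  have h' : (27183 : ℝ) ^ hi ≤ 10000 ^ hi * a ^ c := mod_cast h
  calc Real.exp 1 ^ hi ≤ (27183 / 10000) ^ hi := by gcongr; linarith [Real.exp_one_lt_d9]
    _ ≤ _ := by rw [div_pow, div_le_iff₀' (by positivity)]; exact h'

/-- Checks a list of triples `(b, lo, k)`, each for the block of `n` from the end of the previous
one up to `b`: `[lo, lo + k)` lies in `[n log n, 3 n log n)` and contains at least `b` primes. -/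
def checkBlocks : ℕ → List (ℕ × ℕ × ℕ) → Bool
  | _, [] => true
  | a, (b, lo, k) :: l =>
    decide (1 < lo ∧ lo + k ≤ (min 217 (lo / 5) + 1) ^ 2 ∧ b ^ b * 10000 ^ lo ≤ 27182 ^ lo ∧
      27183 ^ (lo + k) ≤ 10000 ^ (lo + k) * a ^ (3 * a) ∧
      b ≤ coprimeCountChunks (min 217 (lo / 5)).factorial lo (k / 32) +
        coprimeCount (min 217 (lo / 5)).factorial (lo + 32 * (k / 32)) (k % 32)) &&
    checkBlocks (b + 1) l

theorem le_ncard_of_checkBlocks {a n : ℕ} {l : List (ℕ × ℕ × ℕ)} (h : checkBlocks a l) (ha : 0 < a)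
    (han : a ≤ n) (hn : ∃ t ∈ l, n ≤ t.1) :
    n ≤ {p : ℕ | p.Prime ∧ (n : ℝ) * Real.log n ≤ p ∧ (p : ℝ) < 3 * n * Real.log n}.ncard := by
  induction l generalizing a with
  | nil => simp at hn
  | cons t l ih =>
    obtain ⟨b, lo, k⟩ := t
    simp only [checkBlocks, Bool.and_eq_true, decide_eq_true_eq] at h
    obtain ⟨⟨hlo, hhi, hb, ha', hcount⟩, hl⟩ := h
    rcases le_or_gt n b with hnb | hnb
    · have hcard := hcount.trans (add_le_add (coprimeCountChunks_le_card _ _ _)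
        (coprimeCount_le_card _ _ _))
      rw [← card_coprime_Ico_add, Nat.div_add_mod] at hcard
      refine hnb.trans (hcard.trans (card_coprime_factorial_le_ncard hlo hhi ?_ ?_))
      · refine le_trans ?_ (mul_log_le_of_pow_le (by omega) hb)
        have : (0 : ℝ) < n := mod_cast ha.trans_le han
        gcongr
      · refine (le_mul_log_of_le_pow ha ha').trans ?_
        push_cast
        have : (0 : ℝ) < a := mod_cast ha
        gcongr
    · refine ih hl (by omega) hnb ?_
      simpa [hnb.not_ge] using hn

theorem le_ncard_primes_of_le {n : ℕ} (h : 21 ≤ n) (hn : n ≤ 2118) :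
    n ≤ {p : ℕ | p.Prime ∧ (n : ℝ) * Real.log n ≤ p ∧ (p : ℝ) < 3 * n * Real.log n}.ncard := by
  refine le_ncard_of_checkBlocks (a := 21) (l := [
    (22, 69, 122), (25, 81, 135), (29, 98, 156), (32, 111, 195), (36, 130, 216),
    (42, 157, 243), (49, 191, 294), (56, 226, 360), (66, 277, 414), (78, 340, 505),
    (92, 417, 618), (108, 506, 758), (128, 622, 912), (153, 770, 1110), (182, 948, 1379),
    (220, 1187, 1672), (265, 1479, 2099), (322, 1860, 2595), (392, 2341, 3257),
    (479, 2957, 4086), (586, 3735, 5155), (719, 4730, 6496), (886, 6014, 8197),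
    (1097, 7680, 10382), (1362, 9830, 13231), (1696, 12612, 16899), (2118, 16221, 21638)])
    ?_ (by simp) h ⟨(2118, 16221, 21638), by simp, hn⟩
  decide +kernel

theorem log_three_gt : 78 / 71 < Real.log 3 := by
  rw [div_lt_iff₀' (by norm_num), ← Nat.cast_ofNat (n := 71), ← Real.log_pow,
    Real.lt_log_iff_exp_lt (by norm_num), ← mul_one 78, ← Nat.cast_ofNat (n := 78),
    Real.exp_nat_mul]
  have h := Real.exp_one_lt_d9
  calc Real.exp 1 ^ 78 < 2.7182818286 ^ 78 := by gcongr
    _ < 3 ^ 71 := by norm_num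

theorem log_three_lt : Real.log 3 < 11 / 10 := by
  rw [lt_div_iff₀' (by norm_num), ← Nat.cast_ofNat (n := 10), ← Real.log_pow,
    Real.log_lt_iff_lt_exp (by norm_num), ← mul_one 11, ← Nat.cast_ofNat (n := 11),
    Real.exp_nat_mul]
  have h := Real.exp_one_gt_d9
  calc (3 : ℝ) ^ 10 < 2.7182818283 ^ 11 := by norm_num
    _ < Real.exp 1 ^ 11 := by gcongr

theorem log_three_mul_mul_log_le {n : ℝ} (hn : 2048 ≤ n) :
    Real.log (3 * (n * Real.log n)) ≤ 1.411 * Real.log n := by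
  have hL : 7.62461 ≤ Real.log n := by
    have h : Real.log (2 ^ 11) ≤ Real.log n := Real.log_le_log (by norm_num) (by linarith)
    rw [Real.log_pow] at h
    have := Real.log_two_gt_d9
    norm_num at h ⊢
    linarith
  have htangent : Real.log (Real.log n) ≤ Real.log n / 8 - 1 + 3 * Real.log 2 := by
    have h := Real.log_le_sub_one_of_pos (x := Real.log n / 8) (by linarith)
    rw [Real.log_div (by linarith) (by norm_num), show (8 : ℝ) = 2 ^ 3 by norm_num,
      Real.log_pow] at h
    norm_num at h ⊢
    linarith
  rw [Real.log_mul (by norm_num) (by nlinarith), Real.log_mul (by linarith) (by linarith)]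
  linarith [log_three_lt, Real.log_two_lt_d9]

theorem three_mul_log_le {n : ℝ} (hn : 2048 ≤ n) : 3 * Real.log n ≤ 0.1058 ^ 2 * n := by
  have h := Real.log_le_sub_one_of_pos (x := n / 2048) (by linarith)
  rw [Real.log_div (by linarith) (by norm_num), show (2048 : ℝ) = 2 ^ 11 by norm_num,
    Real.log_pow] at h
  have := Real.log_two_lt_d9
  norm_num at h ⊢
  linarith

theorem lt_card_primes_Ioc {n M : ℕ} (hn : 2048 ≤ n) (hM : 2 * M < n * Real.log n)
    (hM' : n * Real.log n ≤ 2 * M + 2) : n < #{p ∈ Ioc (2 * M) (6 * M) | p.Prime} := by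
  have hn' : (2048 : ℝ) ≤ n := mod_cast hn
  set L := Real.log n with hLdef
  have hL : 7.6 ≤ L := by
    have h : Real.log (2 ^ 11) ≤ L := Real.log_le_log (by norm_num) (by linarith)
    rw [Real.log_pow] at h
    have := Real.log_two_gt_d9
    norm_num at h ⊢
    linarith
  have hx : 2048 * 7.6 ≤ n * L := by gcongr
  have hM1 : 7000 ≤ (M : ℝ) := by linarith
  have hM0 : 1 ≤ M := by
    rw [← Nat.cast_le (α := ℝ)]; push_cast; linarith
  have hcount := card_primes_Ioc_mul_log_ge hM0
  set l := Real.log (6 * M) with hl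
  have hl1 : 1 ≤ l := by
    rw [hl, Real.le_log_iff_exp_le (by linarith)]
    linarith [Real.exp_one_lt_d9]
  have hl2 : l ≤ 1.411 * L := by
    refine le_trans (Real.log_le_log (by linarith) ?_) (log_three_mul_mul_log_le hn')
    linarith
  have hl3 : Real.log (4 * M) ≤ l := Real.log_le_log (by linarith) (by linarith)
  have hsqrt : √(6 * M) ≤ 0.1058 * n := by
    rw [Real.sqrt_le_left (by positivity)]
    nlinarith [three_mul_log_le hn']
  have hlog4 : Real.log 4 = 2 * Real.log 2 := by
    rw [show (4 : ℝ) = 2 ^ 2 by norm_num, Real.log_pow]; norm_num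
  have hlog108 : Real.log 108 = 2 * Real.log 2 + 3 * Real.log 3 := by
    rw [show (108 : ℝ) = 2 ^ 2 * 3 ^ 3 by norm_num, Real.log_mul (by norm_num) (by norm_num),
      Real.log_pow, Real.log_pow]
    norm_num
  have hmain : 3.018 * M ≤ M * Real.log 108 - Real.log 4 * (6 * M / 5) := by
    rw [hlog4, hlog108]
    nlinarith [log_three_gt, Real.log_two_lt_d9]
  have hrem : (√(6 * M) / 2 + 1) * l ≤ (0.0529 * n + 1) * l := by
    gcongr
    linarith
  have htotal : (1.0529 * n + 2) * l ≤ 1.412 * 1.0529 * (n * L) + 3 * L := by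
    nlinarith
  have hend : 3 * L ≤ 0.0016 * (n * L) := by nlinarith
  have : (n : ℝ) * l < #{p ∈ Ioc (2 * M) (6 * M) | p.Prime} * l := by
    linarith
  exact_mod_cast lt_of_mul_lt_mul_right this (by linarith)

/-- For every natural number `n > 20`, there are at least `n` primes `p` with
`n·ln n ≤ p < 3·n·ln n`. -/
theorem stmt1 (n : ℕ) (hn : 20 < n) :
    n ≤ {p : ℕ | Nat.Prime p ∧ (n : ℝ) * Real.log n ≤ (p : ℝ) ∧
      (p : ℝ) < 3 * n * Real.log n}.ncard := by
  rcases le_or_gt n 2118 with h | h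
  · exact le_ncard_primes_of_le hn h
  have hx : 0 < n * Real.log n := by
    have := Real.log_pos (x := n) (mod_cast by omega)
    positivity
  obtain ⟨M, hM⟩ : ∃ M, ⌈n * Real.log n / 2⌉₊ = M + 1 :=
    Nat.exists_eq_add_one.2 (Nat.ceil_pos.2 (by linarith))
  have hlt : (M : ℝ) < n * Real.log n / 2 := Nat.lt_ceil.1 (by omega)
  have hle : n * Real.log n / 2 ≤ M + 1 := by
    have := Nat.le_ceil (n * Real.log n / 2)
    rw [hM] at this
    exact_mod_cast this
  have hcard := lt_card_primes_Ioc (n := n) (M := M) (by omega) (by linarith) (by linarith)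
  set s := {p ∈ Ioc (2 * M) (6 * M) | p.Prime}
  have hs : n ≤ #(s.erase (2 * M + 1)) := by
    have := pred_card_le_card_erase (s := s) (a := 2 * M + 1)
    omega
  refine hs.trans ?_
  rw [← Set.ncard_coe_finset]
  refine Set.ncard_le_ncard (fun p hp ↦ ?_) ?_
  · simp only [s, mem_coe, mem_erase, mem_filter, mem_Ioc] at hp
    have h1 : ((2 * M + 2 : ℕ) : ℝ) ≤ p := Nat.cast_le.2 (by omega)
    have h2 : (p : ℝ) ≤ (6 * M : ℕ) := Nat.cast_le.2 hp.2.1.2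
    push_cast at h1 h2
    exact ⟨hp.2.2, by linarith, by linarith⟩
  · refine (Set.finite_Iio ⌈3 * n * Real.log n⌉₊).subset fun p hp ↦ Nat.lt_ceil.2 hp.2.2
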